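/- Let m, n ∈ ℕ_0, Z ∈ {X, Y, XY, WI}, and let u and v be accessible generalized words over a finite alphabet Σ. If u ≡_{m,n}^Z v, then u^{k+1} ≡_{m,k}^Z v^{ω+ω*} for every k with 0 ≤ k ≤ n. -/

import Mathlib

open scoped Classical

/-! ## Generalized words -/

structure GWord (A : Type) : Type 1 where
  P : Type
  ord : LinearOrder P
  w : P → A

namespace GWord

variable {A : Type}

instance (u : GWord A) : LinearOrder u.P := u.ord

/-- The set of letters occurring in a generalized word. -/
def alph (u : GWord A) : Set A := Set.range u.w

/-- Restriction of a generalized word to a set of positions. -/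
def restrict (u : GWord A) (s : Set u.P) : GWord A :=
  ⟨{ p // p ∈ s }, inferInstance, fun p => u.w p.1⟩

/-- `p` is the first `a`-labelled position of `u`. -/
def IsFirst (u : GWord A) (a : A) (p : u.P) : Prop :=
  u.w p = a ∧ ∀ q : u.P, u.w q = a → p ≤ q

/-- `p` is the last `a`-labelled position of `u`. -/
def IsLast (u : GWord A) (a : A) (p : u.P) : Prop :=
  u.w p = a ∧ ∀ q : u.P, u.w q = a → q ≤ p

/-- The factor strictly before the first occurrence of `a`. -/
noncomputable def XL (u : GWord A) (a : A) : GWord A :=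
  if h : ∃ p, u.IsFirst a p then u.restrict {q | q < h.choose} else u

/-- The factor strictly after the first occurrence of `a`. -/
noncomputable def XR (u : GWord A) (a : A) : GWord A :=
  if h : ∃ p, u.IsFirst a p then u.restrict {q | h.choose < q} else u

/-- The factor strictly before the last occurrence of `a`. -/
noncomputable def YL (u : GWord A) (a : A) : GWord A :=
  if h : ∃ p, u.IsLast a p then u.restrict {q | q < h.choose} else u

/-- The factor strictly after the last occurrence of `a`. -/
noncomputable def YR (u : GWord A) (a : A) : GWord A :=
  if h : ∃ p, u.IsLast a p then u.restrict {q | h.choose < q} else u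

/-- `C_{a,b}` is defined iff the first `a` is strictly to the right of the last `b`. -/
def CDefined (u : GWord A) (a b : A) : Prop :=
  ∃ p q, u.IsFirst a p ∧ u.IsLast b q ∧ q < p

/-- The factor strictly between the last `b` and the first `a` (junk value if undefined). -/
noncomputable def Cab (u : GWord A) (a b : A) : GWord A :=
  if h : u.CDefined a b then
    u.restrict {r | h.choose_spec.choose < r ∧ r < h.choose}
  else u

/-- Accessibility: first/last occurrences of letters after/before every position exist. -/
def Accessible (u : GWord A) : Prop :=
  (∀ a : A, (∃ p, u.w p = a) → ∃ p, u.IsFirst a p) ∧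
  (∀ a : A, (∃ p, u.w p = a) → ∃ p, u.IsLast a p) ∧
  (∀ (p : u.P) (a : A), (∃ q, p < q ∧ u.w q = a) →
    ∃ q, p < q ∧ u.w q = a ∧ ∀ r, p < r → u.w r = a → q ≤ r) ∧
  (∀ (p : u.P) (a : A), (∃ q, q < p ∧ u.w q = a) →
    ∃ q, q < p ∧ u.w q = a ∧ ∀ r, r < p → u.w r = a → r ≤ q)

/-- Concatenation of generalized words. -/
def append (u v : GWord A) : GWord A :=
  ⟨u.P ⊕ₗ v.P, inferInstance, fun x => Sum.elim u.w v.w (ofLex x)⟩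

/-- The power of a generalized word by an arbitrary linear order type `ν`
(positions ordered with the exponent component dominant). -/
def gpow (u : GWord A) (ν : Type) [LinearOrder ν] : GWord A :=
  ⟨ν ×ₗ u.P, inferInstance, fun x => u.w (ofLex x).2⟩

/-- A finite word as a generalized word. -/
def ofList (l : List A) : GWord A :=
  ⟨Fin l.length, inferInstance, fun i => l.get i⟩

end GWord

/-- The order type `ω + ω*`: a copy of `ℕ` followed by a reversed copy of `ℕ`. -/
abbrev OO : Type := ℕ ⊕ₗ ℕᵒᵈ

/-! ## The relations `≡_{m,n}^Z` -/

inductive ZK : Type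
  | X | Y | WI

inductive ZKind : Type
  | X | Y | XY | WI

/-- The relations `≡_{m,n}^X`, `≡_{m,n}^Y`, `≡_{m,n}^{WI}` (first argument is `n`). -/
def eqvAux {A : Type} : ℕ → ZK → ℕ → GWord A → GWord A → Prop
  | 0, _, _, _, _ => True
  | _ + 1, _, 0, _, _ => True
  | n + 1, ZK.X, m + 1, u, v =>
      u.alph = v.alph ∧ eqvAux n ZK.Y m u v ∧
      ∀ a ∈ u.alph, eqvAux n ZK.Y m (u.XL a) (v.XL a) ∧
        eqvAux n ZK.X (m + 1) (u.XR a) (v.XR a)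
  | n + 1, ZK.Y, m + 1, u, v =>
      u.alph = v.alph ∧ eqvAux n ZK.X m u v ∧
      ∀ a ∈ u.alph, eqvAux n ZK.Y (m + 1) (u.YL a) (v.YL a) ∧
        eqvAux n ZK.X m (u.YR a) (v.YR a)
  | n + 1, ZK.WI, m + 1, u, v =>
      u.alph = v.alph ∧
      (∀ a ∈ u.alph,
        eqvAux n ZK.WI m (u.XL a) (v.XL a) ∧ eqvAux n ZK.WI (m + 1) (u.XR a) (v.XR a) ∧
        eqvAux n ZK.WI (m + 1) (u.YL a) (v.YL a) ∧ eqvAux n ZK.WI m (u.YR a) (v.YR a)) ∧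
      ∀ a ∈ u.alph, ∀ b ∈ u.alph,
        (u.CDefined a b ↔ v.CDefined a b) ∧
        (u.CDefined a b → v.CDefined a b → eqvAux n ZK.WI m (u.Cab a b) (v.Cab a b))

/-- `wEquiv Z m n u v` is `u ≡_{m,n}^Z v`. -/
def wEquiv {A : Type} (Z : ZKind) (m n : ℕ) (u v : GWord A) : Prop :=
  match Z with
  | ZKind.X => eqvAux n ZK.X m u v
  | ZKind.Y => eqvAux n ZK.Y m u v
  | ZKind.XY => eqvAux n ZK.X m u v ∧ eqvAux n ZK.Y m u v
  | ZKind.WI => eqvAux n ZK.WI m u v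

/-! ## π-terms -/

inductive PiTerm (A : Type) : Type
  | eps : PiTerm A
  | letter : A → PiTerm A
  | mul : PiTerm A → PiTerm A → PiTerm A
  | pi : PiTerm A → PiTerm A

def listNPow {A : Type} (l : List A) : ℕ → List A
  | 0 => []
  | k + 1 => l ++ listNPow l k

/-- `[γ]_k`: substitute the natural number `k` for the formal power `π`. -/
def PiTerm.substNat {A : Type} : PiTerm A → ℕ → List A
  | .eps, _ => []
  | .letter a, _ => [a]
  | .mul α β, k => α.substNat k ++ β.substNat k
  | .pi γ, k => listNPow (γ.substNat k) k

/-- `[γ]_{ω+ω*}`: substitute the order type `ω + ω*` for the formal power `π`. -/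
def PiTerm.substOO {A : Type} : PiTerm A → GWord A
  | .eps => GWord.ofList []
  | .letter a => GWord.ofList [a]
  | .mul α β => α.substOO.append β.substOO
  | .pi γ => γ.substOO.gpow OO

/-! ## Finite monoids, equations, the Trotter–Weil hierarchy -/

/-- `M!`: the exponent of a finite monoid, the least `n ≥ 1` such that all `x^n` are
idempotent. -/
noncomputable def monoidExp (M : Type) [Monoid M] : ℕ :=
  sInf {n : ℕ | 1 ≤ n ∧ ∀ x : M, IsIdempotentElem (x ^ n)}

/-- The equation `α = β` of π-terms holds in the finite monoid `M`. -/
def EqHoldsIn {A : Type} (α β : PiTerm A) (M : Type) [Monoid M] : Prop :=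
  ∀ σ : FreeMonoid A →* M,
    σ (FreeMonoid.ofList (α.substNat (monoidExp M))) =
      σ (FreeMonoid.ofList (β.substNat (monoidExp M)))

/-- Green's relation `R`: `x R y` iff `xM = yM`. -/
def rGreen {M : Type} [Monoid M] (x y : M) : Prop :=
  Set.range (fun z => x * z) = Set.range (fun z => y * z)

/-- Green's relation `L`: `x L y` iff `Mx = My`. -/
def lGreen {M : Type} [Monoid M] (x y : M) : Prop :=
  Set.range (fun z => z * x) = Set.range (fun z => z * y)

/-- `J`-triviality: `MxM = MyM` implies `x = y`. -/
def IsJTrivial (M : Type) [Monoid M] : Prop :=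
  ∀ x y : M, {z | ∃ a b, z = a * x * b} = {z | ∃ a b, z = a * y * b} → x = y

/-- The relation `∼_K`. -/
def simK {M : Type} [Monoid M] (x y : M) : Prop :=
  ∀ e : M, IsIdempotentElem e → (rGreen (e * x) e ∨ rGreen (e * y) e) → e * x = e * y

/-- The relation `∼_D`. -/
def simD {M : Type} [Monoid M] (x y : M) : Prop :=
  ∀ e : M, IsIdempotentElem e → (lGreen (x * e) e ∨ lGreen (y * e) e) → x * e = y * e

/-- `∼_K` as a congruence (it is a congruence, so `conGen` does not change it). -/
def KCon (M : Type) [Monoid M] : Con M := conGen simK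

/-- `∼_D` as a congruence. -/
def DCon (M : Type) [Monoid M] : Con M := conGen simD

/-- `InRLAux k true M _ = (M ∈ R_{k+1})` and `InRLAux k false M _ = (M ∈ L_{k+1})`. -/
def InRLAux : ℕ → Bool → (M : Type) → Monoid M → Prop
  | 0, _, M, i => letI := i; IsJTrivial M
  | k + 1, true, M, i => letI := i; InRLAux k false (KCon M).Quotient inferInstance
  | k + 1, false, M, i => letI := i; InRLAux k true (DCon M).Quotient inferInstance

/-- `M ∈ R_m` (for `m ≥ 1`). -/
def InRm (m : ℕ) (M : Type) [i : Monoid M] : Prop := InRLAux (m - 1) true M i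

/-- `M ∈ L_m` (for `m ≥ 1`). -/
def InLm (m : ℕ) (M : Type) [i : Monoid M] : Prop := InRLAux (m - 1) false M i

/-- `N` divides `M`: `N` is a homomorphic image of a submonoid of `M`. -/
def MDivides (N M : Type) [Monoid N] [Monoid M] : Prop :=
  ∃ (S : Submonoid M) (f : S →* N), Function.Surjective f

/-- `N ∈ R_m ∨ L_m`: `N` divides a direct product `M₁ × M₂` with `M₁ ∈ R_m`, `M₂ ∈ L_m`. -/
def InJoin (m : ℕ) (N : Type) [Monoid N] : Prop :=
  ∃ (M₁ M₂ : Type) (i₁ : Monoid M₁) (i₂ : Monoid M₂),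
    letI := i₁; letI := i₂;
    Finite M₁ ∧ Finite M₂ ∧ InRm m M₁ ∧ InLm m M₂ ∧ MDivides N (M₁ × M₂)

/-- `M ∈ DA`, via the equation `(xyz)^{M!} y (xyz)^{M!} = (xyz)^{M!}`. -/
def InDA (M : Type) [Monoid M] : Prop :=
  ∀ x y z : M,
    (x * y * z) ^ monoidExp M * y * (x * y * z) ^ monoidExp M = (x * y * z) ^ monoidExp M

/-! ## The π-terms `U_m`, `V_m` -/

inductive UVLetter : Type
  | s | t | x (i : ℕ) | y (i : ℕ)

/-- `U_m` (indexed from 1; `Uterm 0` is a junk value). -/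
def Uterm : ℕ → PiTerm UVLetter
  | 0 => PiTerm.eps
  | 1 =>
      PiTerm.mul
        (PiTerm.pi (PiTerm.mul (PiTerm.letter UVLetter.s) (PiTerm.letter (UVLetter.x 1))))
        (PiTerm.mul (PiTerm.letter UVLetter.s)
          (PiTerm.pi (PiTerm.mul (PiTerm.letter (UVLetter.y 1)) (PiTerm.letter UVLetter.t))))
  | m + 2 =>
      PiTerm.mul
        (PiTerm.pi (PiTerm.mul (Uterm (m + 1)) (PiTerm.letter (UVLetter.x (m + 2)))))
        (PiTerm.mul (Uterm (m + 1))
          (PiTerm.pi (PiTerm.mul (PiTerm.letter (UVLetter.y (m + 2))) (Uterm (m + 1)))))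

/-- `V_m` (indexed from 1; `Vterm 0` is a junk value). -/
def Vterm : ℕ → PiTerm UVLetter
  | 0 => PiTerm.eps
  | 1 =>
      PiTerm.mul
        (PiTerm.pi (PiTerm.mul (PiTerm.letter UVLetter.s) (PiTerm.letter (UVLetter.x 1))))
        (PiTerm.mul (PiTerm.letter UVLetter.t)
          (PiTerm.pi (PiTerm.mul (PiTerm.letter (UVLetter.y 1)) (PiTerm.letter UVLetter.t))))
  | m + 2 =>
      PiTerm.mul
        (PiTerm.pi (PiTerm.mul (Uterm (m + 1)) (PiTerm.letter (UVLetter.x (m + 2)))))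
        (PiTerm.mul (Vterm (m + 1))
          (PiTerm.pi (PiTerm.mul (PiTerm.letter (UVLetter.y (m + 2))) (Uterm (m + 1)))))

/-- The relation `≡_{m,n}^Z` on the free monoid `Σ*`, as a congruence
(it is a congruence, so `conGen` does not change it). -/
def eqvCon (A : Type) (Z : ZKind) (m n : ℕ) : Con (FreeMonoid A) :=
  conGen (fun u v => wEquiv Z m n (GWord.ofList u.toList) (GWord.ofList v.toList))
namespace GWord

variable {A : Type}

/-! ### Isomorphism of generalized words -/

/-- Two generalized words are isomorphic if there is a label-preserving order isomorphism between
their sets of positions. -/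
def Iso (u v : GWord A) : Prop := ∃ e : u.P ≃o v.P, ∀ p, v.w (e p) = u.w p

theorem Iso.refl (u : GWord A) : Iso u u := ⟨OrderIso.refl _, fun _ => rfl⟩

theorem Iso.symm {u v : GWord A} : Iso u v → Iso v u := by
  rintro ⟨e, he⟩
  exact ⟨e.symm, fun p => by rw [← he, e.apply_symm_apply]⟩

theorem Iso.trans {u v w : GWord A} : Iso u v → Iso v w → Iso u w := by
  rintro ⟨e, he⟩ ⟨f, hf⟩
  exact ⟨e.trans f, fun p => by rw [OrderIso.trans_apply, hf, he]⟩

theorem Iso.alph_eq {u v : GWord A} : Iso u v → u.alph = v.alph := by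
  rintro ⟨e, he⟩
  have : u.w = v.w ∘ e := funext fun p => (he p).symm
  rw [alph, alph, this, e.surjective.range_comp]

theorem Iso.of_strictMono {u v : GWord A} (f : u.P → v.P) (hf : StrictMono f)
    (hs : Function.Surjective f) (hw : ∀ p, v.w (f p) = u.w p) : Iso u v :=
  ⟨hf.orderIsoOfSurjective f hs, hw⟩

theorem Iso.restrict_of_strictMono {u v : GWord A} {s : Set v.P} (f : u.P → v.P)
    (hf : StrictMono f) (hs : ∀ q, q ∈ s ↔ ∃ p, f p = q) (hw : ∀ p, v.w (f p) = u.w p) :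
    Iso (v.restrict s) u := by
  refine (Iso.of_strictMono (v := v.restrict s) (fun p => ⟨f p, (hs _).2 ⟨p, rfl⟩⟩)
    (fun _ _ h => hf h) ?_ hw).symm
  rintro ⟨q, hq⟩
  obtain ⟨p, rfl⟩ := (hs q).1 hq
  exact ⟨p, rfl⟩

theorem restrict_univ (u : GWord A) {s : Set u.P} (hs : ∀ p, p ∈ s) : Iso (u.restrict s) u :=
  Iso.restrict_of_strictMono id strictMono_id (fun q => by simp [hs]) fun _ => rfl

theorem restrict_iso {u v : GWord A} (e : u.P ≃o v.P) (he : ∀ p, v.w (e p) = u.w p)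
    {s : Set u.P} {t : Set v.P} (h : ∀ p, p ∈ s ↔ e p ∈ t) : Iso (u.restrict s) (v.restrict t) := by
  refine (Iso.restrict_of_strictMono (u := u.restrict s) (fun p => e p.1)
    (fun _ _ h => e.strictMono h) (fun q => ⟨fun hq => ?_, ?_⟩) fun p => he p.1).symm
  · exact ⟨⟨e.symm q, (h _).2 (by simpa using hq)⟩, by simp⟩
  · rintro ⟨p, rfl⟩
    exact (h _).1 p.2

/-! ### First and last occurrences -/

theorem IsFirst.unique {u : GWord A} {a : A} {p q : u.P} (hp : u.IsFirst a p)
    (hq : u.IsFirst a q) : p = q :=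
  le_antisymm (hp.2 q hq.1) (hq.2 p hp.1)

theorem IsLast.unique {u : GWord A} {a : A} {p q : u.P} (hp : u.IsLast a p)
    (hq : u.IsLast a q) : p = q :=
  le_antisymm (hq.2 p hp.1) (hp.2 q hq.1)

theorem IsFirst.XL_eq {u : GWord A} {a : A} {p : u.P} (hp : u.IsFirst a p) :
    u.XL a = u.restrict {q | q < p} := by
  have h : ∃ p, u.IsFirst a p := ⟨p, hp⟩
  rw [XL, dif_pos h, h.choose_spec.unique hp]

theorem IsFirst.XR_eq {u : GWord A} {a : A} {p : u.P} (hp : u.IsFirst a p) :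
    u.XR a = u.restrict {q | p < q} := by
  have h : ∃ p, u.IsFirst a p := ⟨p, hp⟩
  rw [XR, dif_pos h, h.choose_spec.unique hp]

theorem IsLast.YL_eq {u : GWord A} {a : A} {p : u.P} (hp : u.IsLast a p) :
    u.YL a = u.restrict {q | q < p} := by
  have h : ∃ p, u.IsLast a p := ⟨p, hp⟩
  rw [YL, dif_pos h, h.choose_spec.unique hp]

theorem IsLast.YR_eq {u : GWord A} {a : A} {p : u.P} (hp : u.IsLast a p) :
    u.YR a = u.restrict {q | p < q} := by
  have h : ∃ p, u.IsLast a p := ⟨p, hp⟩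
  rw [YR, dif_pos h, h.choose_spec.unique hp]

theorem Cab_eq {u : GWord A} {a b : A} {p q : u.P} (hp : u.IsFirst a p) (hq : u.IsLast b q)
    (hqp : q < p) : u.Cab a b = u.restrict {r | q < r ∧ r < p} := by
  have h : u.CDefined a b := ⟨p, q, hp, hq, hqp⟩
  have hs := h.choose_spec.choose_spec
  rw [Cab, dif_pos h, hs.2.1.unique hq, hs.1.unique hp]

theorem cDefined_iff {u : GWord A} {a b : A} {p q : u.P} (hp : u.IsFirst a p)
    (hq : u.IsLast b q) : u.CDefined a b ↔ q < p := by
  refine ⟨?_, fun h => ⟨p, q, hp, hq, h⟩⟩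
  rintro ⟨p', q', hp', hq', h⟩
  rwa [hp.unique hp', hq.unique hq']

theorem IsFirst.map {u v : GWord A} {a : A} {p : u.P} (e : u.P ≃o v.P)
    (he : ∀ p, v.w (e p) = u.w p) (hp : u.IsFirst a p) : v.IsFirst a (e p) := by
  refine ⟨(he p).trans hp.1, fun q hq => ?_⟩
  rw [← e.apply_symm_apply q] at hq ⊢
  rw [he] at hq
  exact e.monotone (hp.2 _ hq)

theorem IsLast.map {u v : GWord A} {a : A} {p : u.P} (e : u.P ≃o v.P)
    (he : ∀ p, v.w (e p) = u.w p) (hp : u.IsLast a p) : v.IsLast a (e p) := by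
  refine ⟨(he p).trans hp.1, fun q hq => ?_⟩
  rw [← e.apply_symm_apply q] at hq ⊢
  rw [he] at hq
  exact e.monotone (hp.2 _ hq)

theorem Iso.exists_isFirst {u v : GWord A} (h : Iso u v) {a : A} :
    (∃ p, u.IsFirst a p) → ∃ p, v.IsFirst a p := by
  obtain ⟨e, he⟩ := h
  exact fun ⟨p, hp⟩ => ⟨e p, hp.map e he⟩

theorem Iso.exists_isLast {u v : GWord A} (h : Iso u v) {a : A} :
    (∃ p, u.IsLast a p) → ∃ p, v.IsLast a p := by
  obtain ⟨e, he⟩ := h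
  exact fun ⟨p, hp⟩ => ⟨e p, hp.map e he⟩

theorem Iso.XL {u v : GWord A} (h : Iso u v) (a : A) : Iso (u.XL a) (v.XL a) := by
  by_cases hu : ∃ p, u.IsFirst a p
  · obtain ⟨e, he⟩ := h
    obtain ⟨p, hp⟩ := hu
    rw [hp.XL_eq, (hp.map e he).XL_eq]
    exact restrict_iso e he fun q => by simp
  · have hv : ¬ ∃ p, v.IsFirst a p := fun hv => hu (h.symm.exists_isFirst hv)
    rwa [GWord.XL, GWord.XL, dif_neg hu, dif_neg hv]

theorem Iso.XR {u v : GWord A} (h : Iso u v) (a : A) : Iso (u.XR a) (v.XR a) := by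
  by_cases hu : ∃ p, u.IsFirst a p
  · obtain ⟨e, he⟩ := h
    obtain ⟨p, hp⟩ := hu
    rw [hp.XR_eq, (hp.map e he).XR_eq]
    exact restrict_iso e he fun q => by simp
  · have hv : ¬ ∃ p, v.IsFirst a p := fun hv => hu (h.symm.exists_isFirst hv)
    rwa [GWord.XR, GWord.XR, dif_neg hu, dif_neg hv]

theorem Iso.YL {u v : GWord A} (h : Iso u v) (a : A) : Iso (u.YL a) (v.YL a) := by
  by_cases hu : ∃ p, u.IsLast a p
  · obtain ⟨e, he⟩ := h
    obtain ⟨p, hp⟩ := hu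
    rw [hp.YL_eq, (hp.map e he).YL_eq]
    exact restrict_iso e he fun q => by simp
  · have hv : ¬ ∃ p, v.IsLast a p := fun hv => hu (h.symm.exists_isLast hv)
    rwa [GWord.YL, GWord.YL, dif_neg hu, dif_neg hv]

theorem Iso.YR {u v : GWord A} (h : Iso u v) (a : A) : Iso (u.YR a) (v.YR a) := by
  by_cases hu : ∃ p, u.IsLast a p
  · obtain ⟨e, he⟩ := h
    obtain ⟨p, hp⟩ := hu
    rw [hp.YR_eq, (hp.map e he).YR_eq]
    exact restrict_iso e he fun q => by simp
  · have hv : ¬ ∃ p, v.IsLast a p := fun hv => hu (h.symm.exists_isLast hv)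
    rwa [GWord.YR, GWord.YR, dif_neg hu, dif_neg hv]

theorem Iso.cDefined {u v : GWord A} (h : Iso u v) {a b : A} :
    u.CDefined a b → v.CDefined a b := by
  obtain ⟨e, he⟩ := h
  rintro ⟨p, q, hp, hq, hqp⟩
  exact ⟨e p, e q, hp.map e he, hq.map e he, e.strictMono hqp⟩

theorem Iso.cDefined_iff {u v : GWord A} (h : Iso u v) (a b : A) :
    u.CDefined a b ↔ v.CDefined a b :=
  ⟨h.cDefined, h.symm.cDefined⟩

theorem Iso.Cab {u v : GWord A} (h : Iso u v) (a b : A) : Iso (u.Cab a b) (v.Cab a b) := by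
  by_cases hu : u.CDefined a b
  · obtain ⟨e, he⟩ := h
    obtain ⟨p, q, hp, hq, hqp⟩ := hu
    rw [Cab_eq hp hq hqp, Cab_eq (hp.map e he) (hq.map e he) (e.strictMono hqp)]
    exact restrict_iso e he fun q => by simp
  · have hv : ¬ v.CDefined a b := fun hv => hu (h.symm.cDefined hv)
    rwa [GWord.Cab, GWord.Cab, dif_neg hu, dif_neg hv]

/-! ### Accessible words -/

theorem Accessible.exists_isFirst {u : GWord A} (hu : u.Accessible) {a : A} (ha : a ∈ u.alph) :
    ∃ p, u.IsFirst a p :=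
  hu.1 a ha

theorem Accessible.exists_isLast {u : GWord A} (hu : u.Accessible) {a : A} (ha : a ∈ u.alph) :
    ∃ p, u.IsLast a p :=
  hu.2.1 a ha

/-- The restriction of an accessible word to an order-connected set is accessible, as soon as
first and last occurrences of letters within that set exist. -/
theorem Accessible.restrict {u : GWord A} (hu : u.Accessible) {s : Set u.P} (hs : s.OrdConnected)
    (h₁ : ∀ a, ∀ x ∈ s, u.w x = a → ∃ p ∈ s, u.w p = a ∧ ∀ q ∈ s, u.w q = a → p ≤ q)
    (h₂ : ∀ a, ∀ x ∈ s, u.w x = a → ∃ p ∈ s, u.w p = a ∧ ∀ q ∈ s, u.w q = a → q ≤ p) :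
    (u.restrict s).Accessible := by
  refine ⟨?_, ?_, ?_, ?_⟩
  · rintro a ⟨x, hx⟩
    obtain ⟨p, hp, hpa, hmin⟩ := h₁ a x.1 x.2 hx
    exact ⟨⟨p, hp⟩, hpa, fun q hq => hmin q.1 q.2 hq⟩
  · rintro a ⟨x, hx⟩
    obtain ⟨p, hp, hpa, hmax⟩ := h₂ a x.1 x.2 hx
    exact ⟨⟨p, hp⟩, hpa, fun q hq => hmax q.1 q.2 hq⟩
  · rintro p a ⟨x, hpx, hx⟩
    obtain ⟨q, hpq, hqa, hmin⟩ := hu.2.2.1 p.1 a ⟨x.1, hpx, hx⟩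
    have hq : q ∈ s := hs.out p.2 x.2 ⟨hpq.le, hmin x.1 hpx hx⟩
    exact ⟨⟨q, hq⟩, hpq, hqa, fun r hr hra => hmin r.1 hr hra⟩
  · rintro p a ⟨x, hpx, hx⟩
    obtain ⟨q, hpq, hqa, hmax⟩ := hu.2.2.2 p.1 a ⟨x.1, hpx, hx⟩
    have hq : q ∈ s := hs.out x.2 p.2 ⟨hmax x.1 hpx hx, hpq.le⟩
    exact ⟨⟨q, hq⟩, hpq, hqa, fun r hr hra => hmax r.1 hr hra⟩

theorem Accessible.restrict_Iio {u : GWord A} (hu : u.Accessible) (p : u.P) :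
    (u.restrict {q | q < p}).Accessible := by
  refine hu.restrict Set.ordConnected_Iio (fun a x hx hxa => ?_) (fun a x hx hxa => ?_)
  · obtain ⟨q, hqa, hmin⟩ := hu.1 a ⟨x, hxa⟩
    exact ⟨q, (hmin x hxa).trans_lt hx, hqa, fun r _ hr => hmin r hr⟩
  · exact hu.2.2.2 p a ⟨x, hx, hxa⟩

theorem Accessible.restrict_Ioi {u : GWord A} (hu : u.Accessible) (p : u.P) :
    (u.restrict {q | p < q}).Accessible := by
  refine hu.restrict Set.ordConnected_Ioi (fun a x hx hxa => ?_) (fun a x hx hxa => ?_)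
  · exact hu.2.2.1 p a ⟨x, hx, hxa⟩
  · obtain ⟨q, hqa, hmax⟩ := hu.2.1 a ⟨x, hxa⟩
    exact ⟨q, hx.trans_le (hmax x hxa), hqa, fun r _ hr => hmax r hr⟩

theorem Accessible.XL {u : GWord A} (hu : u.Accessible) (a : A) : (u.XL a).Accessible := by
  rw [GWord.XL]
  split_ifs
  exacts [hu.restrict_Iio _, hu]

theorem Accessible.XR {u : GWord A} (hu : u.Accessible) (a : A) : (u.XR a).Accessible := by
  rw [GWord.XR]
  split_ifs
  exacts [hu.restrict_Ioi _, hu]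

theorem Accessible.YL {u : GWord A} (hu : u.Accessible) (a : A) : (u.YL a).Accessible := by
  rw [GWord.YL]
  split_ifs
  exacts [hu.restrict_Iio _, hu]

theorem Accessible.YR {u : GWord A} (hu : u.Accessible) (a : A) : (u.YR a).Accessible := by
  rw [GWord.YR]
  split_ifs
  exacts [hu.restrict_Ioi _, hu]

/-! ### Concatenation -/

/-- The left embedding of positions into a concatenation. -/
def inl {u v : GWord A} (p : u.P) : (u.append v).P := Sum.inlₗ p

/-- The right embedding of positions into a concatenation. -/
def inr {u v : GWord A} (p : v.P) : (u.append v).P := Sum.inrₗ p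

section append

variable {u v : GWord A}

theorem append_cases {motive : (u.append v).P → Prop} (x : (u.append v).P)
    (hl : ∀ p, motive (inl p)) (hr : ∀ p, motive (inr p)) : motive x := by
  rcases x with p | p
  exacts [hl p, hr p]

@[simp] theorem inl_lt_inl {p q : u.P} : (inl p : (u.append v).P) < inl q ↔ p < q :=
  Sum.Lex.inl_lt_inl_iff

@[simp] theorem inr_lt_inr {p q : v.P} : (inr p : (u.append v).P) < inr q ↔ p < q :=
  Sum.Lex.inr_lt_inr_iff

@[simp] theorem inl_lt_inr {p : u.P} {q : v.P} : (inl p : (u.append v).P) < inr q :=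
  Sum.Lex.inl_lt_inr p q

@[simp] theorem not_inr_lt_inl {p : v.P} {q : u.P} : ¬ (inr p : (u.append v).P) < inl q :=
  Sum.Lex.not_inr_lt_inl

@[simp] theorem inl_le_inl {p q : u.P} : (inl p : (u.append v).P) ≤ inl q ↔ p ≤ q :=
  Sum.Lex.inl_le_inl_iff

@[simp] theorem inr_le_inr {p q : v.P} : (inr p : (u.append v).P) ≤ inr q ↔ p ≤ q :=
  Sum.Lex.inr_le_inr_iff

theorem mem_alph_append {a : A} : a ∈ (u.append v).alph ↔ a ∈ u.alph ∨ a ∈ v.alph := by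
  constructor
  · rintro ⟨x, hx⟩
    induction x using append_cases with
    | hl p => exact Or.inl ⟨p, hx⟩
    | hr p => exact Or.inr ⟨p, hx⟩
  · rintro (⟨p, hp⟩ | ⟨p, hp⟩)
    exacts [⟨inl p, hp⟩, ⟨inr p, hp⟩]

theorem IsFirst.inl {a : A} {p : u.P} (hp : u.IsFirst a p) :
    (u.append v).IsFirst a (GWord.inl p) := by
  refine ⟨hp.1, fun x hx => ?_⟩
  induction x using append_cases with
  | hl q => exact inl_le_inl.2 (hp.2 q hx)
  | hr q => exact inl_lt_inr.le

theorem IsFirst.inr {a : A} {p : v.P} (ha : a ∉ u.alph) (hp : v.IsFirst a p) :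
    (u.append v).IsFirst a (GWord.inr p) := by
  refine ⟨hp.1, fun x hx => ?_⟩
  induction x using append_cases with
  | hl q => exact (ha ⟨q, hx⟩).elim
  | hr q => exact inr_le_inr.2 (hp.2 q hx)

theorem IsLast.inr {a : A} {p : v.P} (hp : v.IsLast a p) :
    (u.append v).IsLast a (GWord.inr p) := by
  refine ⟨hp.1, fun x hx => ?_⟩
  induction x using append_cases with
  | hl q => exact inl_lt_inr.le
  | hr q => exact inr_le_inr.2 (hp.2 q hx)

theorem IsLast.inl {a : A} {p : u.P} (ha : a ∉ v.alph) (hp : u.IsLast a p) :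
    (u.append v).IsLast a (GWord.inl p) := by
  refine ⟨hp.1, fun x hx => ?_⟩
  induction x using append_cases with
  | hl q => exact inl_le_inl.2 (hp.2 q hx)
  | hr q => exact (ha ⟨q, hx⟩).elim

theorem restrict_append {s : Set (u.append v).P} {t : Set u.P} {r : Set v.P}
    (ht : ∀ p, inl p ∈ s ↔ p ∈ t) (hr : ∀ p, inr p ∈ s ↔ p ∈ r) :
    Iso ((u.append v).restrict s) ((u.restrict t).append (v.restrict r)) := by
  refine Iso.symm <| Iso.of_strictMono (v := (u.append v).restrict s)
    (fun x => Sum.elim (fun p => ⟨inl p.1, (ht _).2 p.2⟩) (fun p => ⟨inr p.1, (hr _).2 p.2⟩)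
      (ofLex x)) ?_ ?_ ?_
  · intro x y
    induction x using append_cases with
    | hl p =>
      induction y using append_cases with
      | hl q => exact fun h => inl_lt_inl.2 (inl_lt_inl.1 h : p < q)
      | hr q => exact fun _ => inl_lt_inr
    | hr p =>
      induction y using append_cases with
      | hl q => exact fun h => (not_inr_lt_inl h).elim
      | hr q => exact fun h => inr_lt_inr.2 (inr_lt_inr.1 h : p < q)
  · rintro ⟨x, hx⟩
    induction x using append_cases with
    | hl p => exact ⟨inl ⟨p, (ht p).1 hx⟩, rfl⟩
    | hr p => exact ⟨inr ⟨p, (hr p).1 hx⟩, rfl⟩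
  · intro x
    induction x using append_cases with
    | hl p => rfl
    | hr p => rfl

theorem restrict_append_left {s : Set (u.append v).P} {t : Set u.P}
    (ht : ∀ p, inl p ∈ s ↔ p ∈ t) (hr : ∀ p, inr p ∉ s) :
    Iso ((u.append v).restrict s) (u.restrict t) := by
  refine Iso.restrict_of_strictMono (u := u.restrict t) (fun p => inl p.1)
    (fun _ _ h => inl_lt_inl.2 h) (fun x => ⟨?_, ?_⟩) fun _ => rfl
  · induction x using append_cases with
    | hl p => exact fun hx => ⟨⟨p, (ht p).1 hx⟩, rfl⟩
    | hr p => exact fun hx => (hr p hx).elim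
  · rintro ⟨p, rfl⟩
    exact (ht _).2 p.2

theorem restrict_append_right {s : Set (u.append v).P} {r : Set v.P}
    (ht : ∀ p, inl p ∉ s) (hr : ∀ p, inr p ∈ s ↔ p ∈ r) :
    Iso ((u.append v).restrict s) (v.restrict r) := by
  refine Iso.restrict_of_strictMono (u := v.restrict r) (fun p => inr p.1)
    (fun _ _ h => inr_lt_inr.2 h) (fun x => ⟨?_, ?_⟩) fun _ => rfl
  · induction x using append_cases with
    | hl p => exact fun hx => (ht p hx).elim
    | hr p => exact fun hx => ⟨⟨p, (hr p).1 hx⟩, rfl⟩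
  · rintro ⟨p, rfl⟩
    exact (hr _).2 p.2

theorem Iso.append {u' v' : GWord A} (hu : Iso u u') (hv : Iso v v') :
    Iso (u.append v) (u'.append v') := by
  obtain ⟨e, he⟩ := hu
  obtain ⟨f, hf⟩ := hv
  refine ⟨e.sumLexCongr f, fun x => ?_⟩
  induction x using append_cases with
  | hl p => exact he p
  | hr p => exact hf p

theorem restrict_append_whole_right {s : Set (u.append v).P} {t : Set u.P}
    (ht : ∀ p, inl p ∈ s ↔ p ∈ t) (hr : ∀ p, inr p ∈ s) :
    Iso ((u.append v).restrict s) ((u.restrict t).append v) :=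
  (restrict_append (r := Set.univ) ht (by simpa using hr)).trans
    ((Iso.refl _).append (restrict_univ v Set.mem_univ))

theorem restrict_append_whole_left {s : Set (u.append v).P} {r : Set v.P}
    (ht : ∀ p, inl p ∈ s) (hr : ∀ p, inr p ∈ s ↔ p ∈ r) :
    Iso ((u.append v).restrict s) (u.append (v.restrict r)) :=
  (restrict_append (t := Set.univ) (by simpa using ht) hr).trans
    ((restrict_univ u Set.mem_univ).append (Iso.refl _))

variable {a b : A}

theorem append_XL_of_mem (hu : u.Accessible) (ha : a ∈ u.alph) :
    Iso ((u.append v).XL a) (u.XL a) := by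
  obtain ⟨p, hp⟩ := hu.exists_isFirst ha
  rw [hp.inl.XL_eq, hp.XL_eq]
  exact restrict_append_left (by simp) (by simp)

theorem append_XR_of_mem (hu : u.Accessible) (ha : a ∈ u.alph) :
    Iso ((u.append v).XR a) ((u.XR a).append v) := by
  obtain ⟨p, hp⟩ := hu.exists_isFirst ha
  rw [hp.inl.XR_eq, hp.XR_eq]
  exact restrict_append_whole_right (by simp) (by simp)

theorem append_XL_of_notMem (hv : v.Accessible) (ha : a ∉ u.alph) (ha' : a ∈ v.alph) :
    Iso ((u.append v).XL a) (u.append (v.XL a)) := by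
  obtain ⟨p, hp⟩ := hv.exists_isFirst ha'
  rw [(hp.inr ha).XL_eq, hp.XL_eq]
  exact restrict_append_whole_left (by simp) (by simp)

theorem append_XR_of_notMem (hv : v.Accessible) (ha : a ∉ u.alph) (ha' : a ∈ v.alph) :
    Iso ((u.append v).XR a) (v.XR a) := by
  obtain ⟨p, hp⟩ := hv.exists_isFirst ha'
  rw [(hp.inr ha).XR_eq, hp.XR_eq]
  exact restrict_append_right (by simp) (by simp)

theorem append_YL_of_mem (hv : v.Accessible) (ha : a ∈ v.alph) :
    Iso ((u.append v).YL a) (u.append (v.YL a)) := by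
  obtain ⟨p, hp⟩ := hv.exists_isLast ha
  rw [hp.inr.YL_eq, hp.YL_eq]
  exact restrict_append_whole_left (by simp) (by simp)

theorem append_YR_of_mem (hv : v.Accessible) (ha : a ∈ v.alph) :
    Iso ((u.append v).YR a) (v.YR a) := by
  obtain ⟨p, hp⟩ := hv.exists_isLast ha
  rw [hp.inr.YR_eq, hp.YR_eq]
  exact restrict_append_right (by simp) (by simp)

theorem append_YL_of_notMem (hu : u.Accessible) (ha : a ∉ v.alph) (ha' : a ∈ u.alph) :
    Iso ((u.append v).YL a) (u.YL a) := by
  obtain ⟨p, hp⟩ := hu.exists_isLast ha'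
  rw [(hp.inl ha).YL_eq, hp.YL_eq]
  exact restrict_append_left (by simp) (by simp)

theorem append_YR_of_notMem (hu : u.Accessible) (ha : a ∉ v.alph) (ha' : a ∈ u.alph) :
    Iso ((u.append v).YR a) ((u.YR a).append v) := by
  obtain ⟨p, hp⟩ := hu.exists_isLast ha'
  rw [(hp.inl ha).YR_eq, hp.YR_eq]
  exact restrict_append_whole_right (by simp) (by simp)

theorem not_cDefined_append (hu : u.Accessible) (hv : v.Accessible) (ha : a ∈ u.alph)
    (hb : b ∈ v.alph) : ¬ (u.append v).CDefined a b := by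
  obtain ⟨p, hp⟩ := hu.exists_isFirst ha
  obtain ⟨q, hq⟩ := hv.exists_isLast hb
  rw [cDefined_iff hp.inl hq.inr]
  exact not_inr_lt_inl

theorem cDefined_append_left (hu : u.Accessible) (ha : a ∈ u.alph) (hb : b ∉ v.alph)
    (hb' : b ∈ u.alph) : (u.append v).CDefined a b ↔ u.CDefined a b := by
  obtain ⟨p, hp⟩ := hu.exists_isFirst ha
  obtain ⟨q, hq⟩ := hu.exists_isLast hb'
  rw [cDefined_iff hp.inl (hq.inl hb), cDefined_iff hp hq, inl_lt_inl]

theorem Cab_append_left (hb : b ∉ v.alph) (h : u.CDefined a b) :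
    Iso ((u.append v).Cab a b) (u.Cab a b) := by
  obtain ⟨p, q, hp, hq, hqp⟩ := h
  rw [Cab_eq hp hq hqp, Cab_eq hp.inl (hq.inl hb) (inl_lt_inl.2 hqp)]
  exact restrict_append_left (by simp) (by simp)

theorem cDefined_append_right (hv : v.Accessible) (ha : a ∉ u.alph) (ha' : a ∈ v.alph)
    (hb : b ∈ v.alph) : (u.append v).CDefined a b ↔ v.CDefined a b := by
  obtain ⟨p, hp⟩ := hv.exists_isFirst ha'
  obtain ⟨q, hq⟩ := hv.exists_isLast hb
  rw [cDefined_iff (hp.inr ha) hq.inr, cDefined_iff hp hq, inr_lt_inr]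

theorem Cab_append_right (ha : a ∉ u.alph) (h : v.CDefined a b) :
    Iso ((u.append v).Cab a b) (v.Cab a b) := by
  obtain ⟨p, q, hp, hq, hqp⟩ := h
  rw [Cab_eq hp hq hqp, Cab_eq (hp.inr ha) hq.inr (inr_lt_inr.2 hqp)]
  exact restrict_append_right (by simp) (by simp)

theorem cDefined_append (hu : u.Accessible) (hv : v.Accessible) (ha : a ∉ u.alph)
    (ha' : a ∈ v.alph) (hb : b ∉ v.alph) (hb' : b ∈ u.alph) : (u.append v).CDefined a b := by
  obtain ⟨p, hp⟩ := hv.exists_isFirst ha'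
  obtain ⟨q, hq⟩ := hu.exists_isLast hb'
  exact ⟨_, _, hp.inr ha, hq.inl hb, inl_lt_inr⟩

theorem Cab_append (hu : u.Accessible) (hv : v.Accessible) (ha : a ∉ u.alph)
    (ha' : a ∈ v.alph) (hb : b ∉ v.alph) (hb' : b ∈ u.alph) :
    Iso ((u.append v).Cab a b) ((u.YR b).append (v.XL a)) := by
  obtain ⟨p, hp⟩ := hv.exists_isFirst ha'
  obtain ⟨q, hq⟩ := hu.exists_isLast hb'
  rw [Cab_eq (hp.inr ha) (hq.inl hb) inl_lt_inr, hq.YR_eq, hp.XL_eq]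
  exact restrict_append (by simp) (by simp)

end append

/-! ### Powers -/

section gpow

variable {u : GWord A} {ν μ : Type} [LinearOrder ν] [LinearOrder μ]

/-- The position of a power given by an exponent and a position of the base. -/
def pos (i : ν) (p : u.P) : (u.gpow ν).P := toLex (i, p)

theorem pos_lt_pos {i j : ν} {p q : u.P} :
    (pos i p : (u.gpow ν).P) < pos j q ↔ i < j ∨ i = j ∧ p < q :=
  Prod.Lex.lt_iff

theorem pos_le_pos {i j : ν} {p q : u.P} :
    (pos i p : (u.gpow ν).P) ≤ pos j q ↔ i < j ∨ i = j ∧ p ≤ q :=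
  Prod.Lex.le_iff

theorem gpow_cases {motive : (u.gpow ν).P → Prop} (x : (u.gpow ν).P)
    (h : ∀ i p, motive (pos i p)) : motive x :=
  h x.1 x.2

theorem alph_gpow [Nonempty ν] : (u.gpow ν).alph = u.alph := by
  ext a
  constructor
  · rintro ⟨x, hx⟩
    exact ⟨_, hx⟩
  · rintro ⟨p, hp⟩
    exact ⟨pos (Classical.arbitrary ν) p, hp⟩

theorem gpow_cons (z : ν) (g : μ → ν) (hg : StrictMono g) (hz : ∀ i, z < g i)
    (hs : ∀ j, j = z ∨ ∃ i, g i = j) : Iso (u.gpow ν) (u.append (u.gpow μ)) := by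
  refine Iso.symm <| Iso.of_strictMono (v := u.gpow ν)
    (fun x => Sum.elim (fun p => pos z p) (fun y => pos (g (ofLex y).1) (ofLex y).2) (ofLex x))
    ?_ ?_ ?_
  · intro x y
    induction x using append_cases with
    | hl p =>
      induction y using append_cases with
      | hl q => exact fun h => pos_lt_pos.2 (Or.inr ⟨rfl, inl_lt_inl.1 h⟩)
      | hr q => exact fun _ => pos_lt_pos.2 (Or.inl (hz _))
    | hr p =>
      induction y using append_cases with
      | hl q => exact fun h => (not_inr_lt_inl h).elim
      | hr q =>
        intro h
        rcases pos_lt_pos.1 (inr_lt_inr.1 h) with h | ⟨h, h'⟩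
        · exact pos_lt_pos.2 (Or.inl (hg h))
        · exact pos_lt_pos.2 (Or.inr ⟨congrArg g h, h'⟩)
  · intro x
    induction x using gpow_cases with
    | h j p =>
      rcases hs j with rfl | ⟨i, rfl⟩
      · exact ⟨inl p, rfl⟩
      · exact ⟨inr (pos i p), rfl⟩
  · intro x
    induction x using append_cases with
    | hl p => rfl
    | hr p => rfl

theorem gpow_snoc (z : ν) (g : μ → ν) (hg : StrictMono g) (hz : ∀ i, g i < z)
    (hs : ∀ j, j = z ∨ ∃ i, g i = j) : Iso (u.gpow ν) ((u.gpow μ).append u) := by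
  refine Iso.symm <| Iso.of_strictMono (v := u.gpow ν)
    (fun x => Sum.elim (fun y => pos (g (ofLex y).1) (ofLex y).2) (fun p => pos z p) (ofLex x))
    ?_ ?_ ?_
  · intro x y
    induction x using append_cases with
    | hl p =>
      induction y using append_cases with
      | hl q =>
        intro h
        rcases pos_lt_pos.1 (inl_lt_inl.1 h) with h | ⟨h, h'⟩
        · exact pos_lt_pos.2 (Or.inl (hg h))
        · exact pos_lt_pos.2 (Or.inr ⟨congrArg g h, h'⟩)
      | hr q => exact fun _ => pos_lt_pos.2 (Or.inl (hz _))
    | hr p =>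
      induction y using append_cases with
      | hl q => exact fun h => (not_inr_lt_inl h).elim
      | hr q => exact fun h => pos_lt_pos.2 (Or.inr ⟨rfl, inr_lt_inr.1 h⟩)
  · intro x
    induction x using gpow_cases with
    | h j p =>
      rcases hs j with rfl | ⟨i, rfl⟩
      · exact ⟨inr p, rfl⟩
      · exact ⟨inl (pos i p), rfl⟩
  · intro x
    induction x using append_cases with
    | hl p => rfl
    | hr p => rfl

/-- A power of an accessible word is accessible if the exponent has endpoints and all its
non-maximal (non-minimal) elements have immediate successors (predecessors). -/
theorem Accessible.gpow (hu : u.Accessible) [BoundedOrder ν]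
    (hsucc : ∀ i j : ν, i < j → ∃ s, i < s ∧ ∀ k, i < k → s ≤ k)
    (hpred : ∀ i j : ν, j < i → ∃ s, s < i ∧ ∀ k, k < i → k ≤ s) :
    (u.gpow ν).Accessible := by
  refine ⟨?_, ?_, ?_, ?_⟩
  · rintro a ⟨x, hx⟩
    obtain ⟨p, hp⟩ := hu.1 a ⟨_, hx⟩
    refine ⟨pos ⊥ p, hp.1, fun y => ?_⟩
    induction y using gpow_cases with
    | h j q =>
      intro hy
      rcases (bot_le (a := j)).lt_or_eq with h | h
      exacts [pos_le_pos.2 (Or.inl h), pos_le_pos.2 (Or.inr ⟨h, hp.2 q hy⟩)]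
  · rintro a ⟨x, hx⟩
    obtain ⟨p, hp⟩ := hu.2.1 a ⟨_, hx⟩
    refine ⟨pos ⊤ p, hp.1, fun y => ?_⟩
    induction y using gpow_cases with
    | h j q =>
      intro hy
      rcases (le_top (a := j)).lt_or_eq with h | h
      exacts [pos_le_pos.2 (Or.inl h), pos_le_pos.2 (Or.inr ⟨h, hp.2 q hy⟩)]
  · rintro x a ⟨y, hxy, hy⟩
    induction x using gpow_cases with
    | h i p =>
    by_cases ha : ∃ q, p < q ∧ u.w q = a
    · obtain ⟨q, hpq, hqa, hmin⟩ := hu.2.2.1 p a ha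
      refine ⟨pos i q, pos_lt_pos.2 (Or.inr ⟨rfl, hpq⟩), hqa, fun z => ?_⟩
      induction z using gpow_cases with
      | h k r =>
        intro hz hza
        rcases pos_lt_pos.1 hz with h | ⟨h, h'⟩
        exacts [pos_le_pos.2 (Or.inl h), pos_le_pos.2 (Or.inr ⟨h, hmin r h' hza⟩)]
    · obtain ⟨q, hqa, hmin⟩ := hu.1 a ⟨_, hy⟩
      induction y using gpow_cases with
      | h j r =>
      have hij : i < j := by
        rcases pos_lt_pos.1 hxy with h | ⟨_, h⟩
        exacts [h, (ha ⟨r, h, hy⟩).elim]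
      obtain ⟨s, his, hs⟩ := hsucc i j hij
      refine ⟨pos s q, pos_lt_pos.2 (Or.inl his), hqa, fun z => ?_⟩
      induction z using gpow_cases with
      | h k t =>
        intro hz hza
        rcases pos_lt_pos.1 hz with h | ⟨_, h⟩
        · rcases (hs k h).lt_or_eq with h | h
          exacts [pos_le_pos.2 (Or.inl h), pos_le_pos.2 (Or.inr ⟨h, hmin t hza⟩)]
        · exact (ha ⟨t, h, hza⟩).elim
  · rintro x a ⟨y, hxy, hy⟩
    induction x using gpow_cases with
    | h i p =>
    by_cases ha : ∃ q, q < p ∧ u.w q = a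
    · obtain ⟨q, hpq, hqa, hmax⟩ := hu.2.2.2 p a ha
      refine ⟨pos i q, pos_lt_pos.2 (Or.inr ⟨rfl, hpq⟩), hqa, fun z => ?_⟩
      induction z using gpow_cases with
      | h k r =>
        intro hz hza
        rcases pos_lt_pos.1 hz with h | ⟨h, h'⟩
        exacts [pos_le_pos.2 (Or.inl h), pos_le_pos.2 (Or.inr ⟨h, hmax r h' hza⟩)]
    · obtain ⟨q, hqa, hmax⟩ := hu.2.1 a ⟨_, hy⟩
      induction y using gpow_cases with
      | h j r =>
      have hij : j < i := by
        rcases pos_lt_pos.1 hxy with h | ⟨_, h⟩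
        exacts [h, (ha ⟨r, h, hy⟩).elim]
      obtain ⟨s, his, hs⟩ := hpred i j hij
      refine ⟨pos s q, pos_lt_pos.2 (Or.inl his), hqa, fun z => ?_⟩
      induction z using gpow_cases with
      | h k t =>
        intro hz hza
        rcases pos_lt_pos.1 hz with h | ⟨_, h⟩
        · rcases (hs k h).lt_or_eq with h | h
          exacts [pos_le_pos.2 (Or.inl h), pos_le_pos.2 (Or.inr ⟨h, hmax t hza⟩)]
        · exact (ha ⟨t, h, hza⟩).elim

theorem Accessible.gpow_fin (hu : u.Accessible) (j : ℕ) : (u.gpow (Fin (j + 1))).Accessible := by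
  refine hu.gpow (fun i k hik => ?_) (fun i k hik => ?_)
  · exact ⟨⟨i + 1, by omega⟩, Fin.lt_def.2 (by simp), fun l hl => Fin.le_def.2 (Fin.lt_def.1 hl)⟩
  · exact ⟨⟨i - 1, by omega⟩, Fin.lt_def.2 (by simp only; omega),
      fun l hl => Fin.le_def.2 (by simp only; omega)⟩

theorem gpow_fin_cons (j : ℕ) : Iso (u.gpow (Fin (j + 1))) (u.append (u.gpow (Fin j))) :=
  gpow_cons 0 Fin.succ Fin.strictMono_succ Fin.succ_pos fun i =>
    (Fin.eq_zero_or_eq_succ i).imp_right fun ⟨k, hk⟩ => ⟨k, hk.symm⟩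

theorem gpow_fin_snoc (j : ℕ) : Iso (u.gpow (Fin (j + 1))) ((u.gpow (Fin j)).append u) :=
  gpow_snoc (Fin.last j) Fin.castSucc Fin.strictMono_castSucc Fin.castSucc_lt_last fun i =>
    (Fin.eq_castSucc_or_eq_last i).symm.imp_right fun ⟨k, hk⟩ => ⟨k, hk.symm⟩

theorem Accessible.gpow_OO (hu : u.Accessible) : (u.gpow OO).Accessible := by
  let _ : BoundedOrder OO :=
    { bot := Sum.inlₗ 0
      bot_le := by
        rintro (i | i)
        exacts [Sum.Lex.inl_le_inl_iff.2 (Nat.zero_le i), Sum.Lex.inl_le_inr _ _]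
      top := Sum.inrₗ (OrderDual.toDual 0)
      le_top := by
        rintro (i | i)
        exacts [Sum.Lex.inl_le_inr _ _, Sum.Lex.inr_le_inr_iff.2 (Nat.zero_le i.ofDual)] }
  refine hu.gpow ?_ ?_
  · rintro (i | _ | i) j hij
    · refine ⟨Sum.inlₗ (i + 1), Sum.Lex.inl_lt_inl_iff.2 i.lt_succ_self, ?_⟩
      rintro (k | k) hk
      · exact Sum.Lex.inl_le_inl_iff.2 (Sum.Lex.inl_lt_inl_iff.1 hk)
      · exact Sum.Lex.inl_le_inr _ _
    · exact (not_lt_of_ge (le_top (a := j)) hij).elim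
    · refine ⟨Sum.inrₗ (OrderDual.toDual i), Sum.Lex.inr_lt_inr_iff.2 i.lt_succ_self, ?_⟩
      rintro (k | k) hk
      · exact (Sum.Lex.not_inr_lt_inl hk).elim
      · have hki : k.ofDual < i + 1 :=
          (Sum.Lex.inr_lt_inr_iff (a := OrderDual.toDual (i + 1)) (b := k)).1 hk
        exact Sum.Lex.inr_le_inr_iff.2 (Nat.le_of_lt_succ hki)
  · rintro ((_ | i) | i) j hij
    · exact (not_lt_of_ge (bot_le (a := j)) hij).elim
    · refine ⟨Sum.inlₗ i, Sum.Lex.inl_lt_inl_iff.2 i.lt_succ_self, ?_⟩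
      rintro (k | k) hk
      · exact Sum.Lex.inl_le_inl_iff.2 (Nat.le_of_lt_succ (Sum.Lex.inl_lt_inl_iff.1 hk))
      · exact (Sum.Lex.not_inr_lt_inl hk).elim
    · refine ⟨Sum.inrₗ (OrderDual.toDual (i.ofDual + 1)),
        Sum.Lex.inr_lt_inr_iff.2 (Nat.lt_succ_self i.ofDual), ?_⟩
      rintro (k | k) hk
      · exact Sum.Lex.inl_le_inr _ _
      · have hik : i.ofDual < k.ofDual := (Sum.Lex.inr_lt_inr_iff (a := k) (b := i)).1 hk
        exact Sum.Lex.inr_le_inr_iff.2 (Nat.succ_le_of_lt hik)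

theorem gpow_OO_cons : Iso (u.gpow OO) (u.append (u.gpow OO)) := by
  refine gpow_cons (Sum.inlₗ 0)
    (fun x => Sum.elim (fun i => Sum.inlₗ (i + 1)) (fun i => Sum.inrₗ i) (ofLex x)) ?_ ?_ ?_
  · rintro (i | i) (k | k) h
    · exact Sum.Lex.inl_lt_inl_iff.2 (Nat.succ_lt_succ (Sum.Lex.inl_lt_inl_iff.1 h))
    · exact Sum.Lex.inl_lt_inr _ _
    · exact (Sum.Lex.not_inr_lt_inl h).elim
    · exact h
  · rintro (i | i)
    exacts [Sum.Lex.inl_lt_inl_iff.2 (Nat.succ_pos i), Sum.Lex.inl_lt_inr _ _]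
  · rintro ((_ | i) | i)
    exacts [Or.inl rfl, Or.inr ⟨Sum.inlₗ i, rfl⟩, Or.inr ⟨Sum.inrₗ i, rfl⟩]

theorem gpow_OO_snoc : Iso (u.gpow OO) ((u.gpow OO).append u) := by
  refine gpow_snoc (Sum.inrₗ (OrderDual.toDual 0))
    (fun x => Sum.elim (fun i => Sum.inlₗ i)
      (fun i => Sum.inrₗ (OrderDual.toDual (i.ofDual + 1))) (ofLex x)) ?_ ?_ ?_
  · rintro (i | i) (k | k) h
    · exact h
    · exact Sum.Lex.inl_lt_inr _ _
    · exact (Sum.Lex.not_inr_lt_inl h).elim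
    · have hki : k.ofDual < i.ofDual := (Sum.Lex.inr_lt_inr_iff (a := i) (b := k)).1 h
      exact Sum.Lex.inr_lt_inr_iff.2 (Nat.succ_lt_succ hki)
  · rintro (i | i)
    exacts [Sum.Lex.inl_lt_inr _ _, Sum.Lex.inr_lt_inr_iff.2 (Nat.succ_pos i.ofDual)]
  · rintro (i | (_ | i))
    exacts [Or.inr ⟨Sum.inlₗ i, rfl⟩, Or.inl rfl, Or.inr ⟨Sum.inrₗ (OrderDual.toDual i), rfl⟩]

end gpow

end GWord

/-! ### Properties of the relations -/

section eqv

open GWord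

variable {A : Type}

theorem eqvAux_X {n m : ℕ} {u v : GWord A} : eqvAux (n + 1) ZK.X (m + 1) u v ↔
    u.alph = v.alph ∧ eqvAux n ZK.Y m u v ∧
      ∀ a ∈ u.alph, eqvAux n ZK.Y m (u.XL a) (v.XL a) ∧
        eqvAux n ZK.X (m + 1) (u.XR a) (v.XR a) := by
  rw [eqvAux]

theorem eqvAux_Y {n m : ℕ} {u v : GWord A} : eqvAux (n + 1) ZK.Y (m + 1) u v ↔
    u.alph = v.alph ∧ eqvAux n ZK.X m u v ∧
      ∀ a ∈ u.alph, eqvAux n ZK.Y (m + 1) (u.YL a) (v.YL a) ∧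
        eqvAux n ZK.X m (u.YR a) (v.YR a) := by
  rw [eqvAux]

theorem eqvAux_WI {n m : ℕ} {u v : GWord A} : eqvAux (n + 1) ZK.WI (m + 1) u v ↔
    u.alph = v.alph ∧
      (∀ a ∈ u.alph,
        eqvAux n ZK.WI m (u.XL a) (v.XL a) ∧ eqvAux n ZK.WI (m + 1) (u.XR a) (v.XR a) ∧
        eqvAux n ZK.WI (m + 1) (u.YL a) (v.YL a) ∧ eqvAux n ZK.WI m (u.YR a) (v.YR a)) ∧
      ∀ a ∈ u.alph, ∀ b ∈ u.alph,
        (u.CDefined a b ↔ v.CDefined a b) ∧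
        (u.CDefined a b → v.CDefined a b → eqvAux n ZK.WI m (u.Cab a b) (v.Cab a b)) := by
  rw [eqvAux]

theorem eqvAux_zero_left (k : ZK) (m : ℕ) (u v : GWord A) : eqvAux 0 k m u v := by
  simp [eqvAux]

theorem eqvAux_zero_right (n : ℕ) (k : ZK) (u v : GWord A) : eqvAux n k 0 u v := by
  cases n <;> simp [eqvAux]

theorem eqvAux.alph_eq {n m : ℕ} {k : ZK} {u v : GWord A}
    (h : eqvAux (n + 1) k (m + 1) u v) : u.alph = v.alph := by
  cases k
  exacts [(eqvAux_X.1 h).1, (eqvAux_Y.1 h).1, (eqvAux_WI.1 h).1]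

theorem eqvAux.congr {n m : ℕ} {k : ZK} {u v u' v' : GWord A} (h : eqvAux n k m u v)
    (hu : Iso u u') (hv : Iso v v') : eqvAux n k m u' v' := by
  induction n generalizing m k u v u' v' with
  | zero => exact eqvAux_zero_left ..
  | succ n ih =>
  cases m with
  | zero => exact eqvAux_zero_right ..
  | succ m =>
  have halph : u'.alph = v'.alph := by rw [← hu.alph_eq, ← hv.alph_eq, h.alph_eq]
  cases k with
  | X =>
    rw [eqvAux_X] at h
    rw [eqvAux_X, ← hu.alph_eq]
    exact ⟨hu.alph_eq.trans halph, ih h.2.1 hu hv, fun a ha =>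
      ⟨ih (h.2.2 a ha).1 (hu.XL a) (hv.XL a), ih (h.2.2 a ha).2 (hu.XR a) (hv.XR a)⟩⟩
  | Y =>
    rw [eqvAux_Y] at h
    rw [eqvAux_Y, ← hu.alph_eq]
    exact ⟨hu.alph_eq.trans halph, ih h.2.1 hu hv, fun a ha =>
      ⟨ih (h.2.2 a ha).1 (hu.YL a) (hv.YL a), ih (h.2.2 a ha).2 (hu.YR a) (hv.YR a)⟩⟩
  | WI =>
    rw [eqvAux_WI] at h ⊢
    refine ⟨halph, fun a ha => ?_, fun a ha b hb => ?_⟩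
    · obtain ⟨h₁, h₂, h₃, h₄⟩ := h.2.1 a (hu.alph_eq ▸ ha)
      exact ⟨ih h₁ (hu.XL a) (hv.XL a), ih h₂ (hu.XR a) (hv.XR a), ih h₃ (hu.YL a) (hv.YL a),
        ih h₄ (hu.YR a) (hv.YR a)⟩
    · obtain ⟨h₁, h₂⟩ := h.2.2 a (hu.alph_eq ▸ ha) b (hu.alph_eq ▸ hb)
      rw [← hu.cDefined_iff, ← hv.cDefined_iff]
      exact ⟨h₁, fun hu' hv' => ih (h₂ hu' hv') (hu.Cab a b) (hv.Cab a b)⟩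

/-- The relations become coarser when `n` decreases. -/
theorem eqvAux.of_succ_left {n m : ℕ} {k : ZK} {u v : GWord A} (h : eqvAux (n + 1) k m u v) :
    eqvAux n k m u v := by
  induction n generalizing m k u v with
  | zero => exact eqvAux_zero_left ..
  | succ n ih =>
  cases m with
  | zero => exact eqvAux_zero_right ..
  | succ m =>
  cases k with
  | X =>
    rw [eqvAux_X] at h ⊢
    exact ⟨h.1, ih h.2.1, fun a ha => (h.2.2 a ha).imp ih ih⟩
  | Y =>
    rw [eqvAux_Y] at h ⊢
    exact ⟨h.1, ih h.2.1, fun a ha => (h.2.2 a ha).imp ih ih⟩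
  | WI =>
    rw [eqvAux_WI] at h ⊢
    exact ⟨h.1, fun a ha => (h.2.1 a ha).imp ih (And.imp ih (And.imp ih ih)),
      fun a ha b hb => (h.2.2 a ha b hb).imp_right fun h hu hv => ih (h hu hv)⟩

/-- The relations become coarser when `m` decreases. -/
theorem eqvAux.of_succ_right {n m : ℕ} {k : ZK} {u v : GWord A} (h : eqvAux n k (m + 1) u v) :
    eqvAux n k m u v := by
  induction n generalizing m k u v with
  | zero => exact eqvAux_zero_left ..
  | succ n ih =>
  cases m with
  | zero => exact eqvAux_zero_right ..
  | succ m =>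
  cases k with
  | X =>
    rw [eqvAux_X] at h ⊢
    exact ⟨h.1, ih h.2.1, fun a ha => (h.2.2 a ha).imp ih ih⟩
  | Y =>
    rw [eqvAux_Y] at h ⊢
    exact ⟨h.1, ih h.2.1, fun a ha => (h.2.2 a ha).imp ih ih⟩
  | WI =>
    rw [eqvAux_WI] at h ⊢
    exact ⟨h.1, fun a ha => (h.2.1 a ha).imp ih (And.imp ih (And.imp ih ih)),
      fun a ha b hb => (h.2.2 a ha b hb).imp_right fun h hu hv => ih (h hu hv)⟩

/-- The relations are compatible with concatenation of accessible words. -/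
theorem eqvAux.append {n m : ℕ} {k : ZK} {u v u' v' : GWord A} (hu : u.Accessible)
    (hv : v.Accessible) (hu' : u'.Accessible) (hv' : v'.Accessible) (h : eqvAux n k m u v)
    (h' : eqvAux n k m u' v') : eqvAux n k m (u.append u') (v.append v') := by
  induction n generalizing m k u v u' v' with
  | zero => exact eqvAux_zero_left ..
  | succ n ih =>
  cases m with
  | zero => exact eqvAux_zero_right ..
  | succ m =>
  have e : u.alph = v.alph := h.alph_eq
  have e' : u'.alph = v'.alph := h'.alph_eq
  have halph : (u.append u').alph = (v.append v').alph := by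
    ext a
    rw [mem_alph_append, mem_alph_append, e, e']
  cases k with
  | X =>
    rw [eqvAux_X]
    refine ⟨halph, ih hu hv hu' hv' (eqvAux_X.1 h).2.1 (eqvAux_X.1 h').2.1, fun a ha => ?_⟩
    by_cases hau : a ∈ u.alph
    · have hav : a ∈ v.alph := e ▸ hau
      obtain ⟨h₁, h₂⟩ := (eqvAux_X.1 h).2.2 a hau
      exact ⟨h₁.congr (append_XL_of_mem hu hau).symm (append_XL_of_mem hv hav).symm,
        (ih (hu.XR a) (hv.XR a) hu' hv' h₂ h'.of_succ_left).congr
          (append_XR_of_mem hu hau).symm (append_XR_of_mem hv hav).symm⟩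
    · have hav : a ∉ v.alph := e ▸ hau
      have hau' : a ∈ u'.alph := (mem_alph_append.1 ha).resolve_left hau
      have hav' : a ∈ v'.alph := e' ▸ hau'
      obtain ⟨h₁, h₂⟩ := (eqvAux_X.1 h').2.2 a hau'
      exact ⟨(ih hu hv (hu'.XL a) (hv'.XL a) (eqvAux_X.1 h).2.1 h₁).congr
          (append_XL_of_notMem hu' hau hau').symm (append_XL_of_notMem hv' hav hav').symm,
        h₂.congr (append_XR_of_notMem hu' hau hau').symm
          (append_XR_of_notMem hv' hav hav').symm⟩
  | Y =>
    rw [eqvAux_Y]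
    refine ⟨halph, ih hu hv hu' hv' (eqvAux_Y.1 h).2.1 (eqvAux_Y.1 h').2.1, fun a ha => ?_⟩
    by_cases hau' : a ∈ u'.alph
    · have hav' : a ∈ v'.alph := e' ▸ hau'
      obtain ⟨h₁, h₂⟩ := (eqvAux_Y.1 h').2.2 a hau'
      exact ⟨(ih hu hv (hu'.YL a) (hv'.YL a) h.of_succ_left h₁).congr
          (append_YL_of_mem hu' hau').symm (append_YL_of_mem hv' hav').symm,
        h₂.congr (append_YR_of_mem hu' hau').symm (append_YR_of_mem hv' hav').symm⟩
    · have hav' : a ∉ v'.alph := e' ▸ hau'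
      have hau : a ∈ u.alph := (mem_alph_append.1 ha).resolve_right hau'
      have hav : a ∈ v.alph := e ▸ hau
      obtain ⟨h₁, h₂⟩ := (eqvAux_Y.1 h).2.2 a hau
      exact ⟨h₁.congr (append_YL_of_notMem hu hau' hau).symm
          (append_YL_of_notMem hv hav' hav).symm,
        (ih (hu.YR a) (hv.YR a) hu' hv' h₂ (eqvAux_Y.1 h').2.1).congr
          (append_YR_of_notMem hu hau' hau).symm (append_YR_of_notMem hv hav' hav).symm⟩
  | WI =>
    have hm : eqvAux n ZK.WI m u v := h.of_succ_left.of_succ_right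
    have hm' : eqvAux n ZK.WI m u' v' := h'.of_succ_left.of_succ_right
    rw [eqvAux_WI]
    refine ⟨halph, fun a ha => and_assoc.1 ⟨?_, ?_⟩, fun a ha b hb => ?_⟩
    · by_cases hau : a ∈ u.alph
      · have hav : a ∈ v.alph := e ▸ hau
        obtain ⟨h₁, h₂, -, -⟩ := (eqvAux_WI.1 h).2.1 a hau
        exact ⟨h₁.congr (append_XL_of_mem hu hau).symm (append_XL_of_mem hv hav).symm,
          (ih (hu.XR a) (hv.XR a) hu' hv' h₂ h'.of_succ_left).congr
            (append_XR_of_mem hu hau).symm (append_XR_of_mem hv hav).symm⟩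
      · have hav : a ∉ v.alph := e ▸ hau
        have hau' : a ∈ u'.alph := (mem_alph_append.1 ha).resolve_left hau
        have hav' : a ∈ v'.alph := e' ▸ hau'
        obtain ⟨h₁, h₂, -, -⟩ := (eqvAux_WI.1 h').2.1 a hau'
        exact ⟨(ih hu hv (hu'.XL a) (hv'.XL a) hm h₁).congr
            (append_XL_of_notMem hu' hau hau').symm (append_XL_of_notMem hv' hav hav').symm,
          h₂.congr (append_XR_of_notMem hu' hau hau').symm
            (append_XR_of_notMem hv' hav hav').symm⟩
    · by_cases hau' : a ∈ u'.alph
      · have hav' : a ∈ v'.alph := e' ▸ hau'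
        obtain ⟨-, -, h₁, h₂⟩ := (eqvAux_WI.1 h').2.1 a hau'
        exact ⟨(ih hu hv (hu'.YL a) (hv'.YL a) h.of_succ_left h₁).congr
            (append_YL_of_mem hu' hau').symm (append_YL_of_mem hv' hav').symm,
          h₂.congr (append_YR_of_mem hu' hau').symm (append_YR_of_mem hv' hav').symm⟩
      · have hav' : a ∉ v'.alph := e' ▸ hau'
        have hau : a ∈ u.alph := (mem_alph_append.1 ha).resolve_right hau'
        have hav : a ∈ v.alph := e ▸ hau
        obtain ⟨-, -, h₁, h₂⟩ := (eqvAux_WI.1 h).2.1 a hau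
        exact ⟨h₁.congr (append_YL_of_notMem hu hau' hau).symm
            (append_YL_of_notMem hv hav' hav).symm,
          (ih (hu.YR a) (hv.YR a) hu' hv' h₂ hm').congr
            (append_YR_of_notMem hu hau' hau).symm (append_YR_of_notMem hv hav' hav).symm⟩
    · by_cases hau : a ∈ u.alph <;> by_cases hbu' : b ∈ u'.alph
      · have hn := not_cDefined_append hu hu' hau hbu'
        exact ⟨iff_of_false hn (not_cDefined_append hv hv' (e ▸ hau) (e' ▸ hbu')),
          fun h => (hn h).elim⟩
      · have hbu : b ∈ u.alph := (mem_alph_append.1 hb).resolve_right hbu'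
        have hbv' : b ∉ v'.alph := e' ▸ hbu'
        obtain ⟨h₁, h₂⟩ := (eqvAux_WI.1 h).2.2 a hau b hbu
        rw [cDefined_append_left hu hau hbu' hbu,
          cDefined_append_left hv (e ▸ hau) hbv' (e ▸ hbu)]
        exact ⟨h₁, fun hcu hcv => (h₂ hcu hcv).congr (Cab_append_left hbu' hcu).symm
          (Cab_append_left hbv' hcv).symm⟩
      · have hau' : a ∈ u'.alph := (mem_alph_append.1 ha).resolve_left hau
        have hav : a ∉ v.alph := e ▸ hau
        obtain ⟨h₁, h₂⟩ := (eqvAux_WI.1 h').2.2 a hau' b hbu'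
        rw [cDefined_append_right hu' hau hau' hbu',
          cDefined_append_right hv' hav (e' ▸ hau') (e' ▸ hbu')]
        exact ⟨h₁, fun hcu hcv => (h₂ hcu hcv).congr (Cab_append_right hau hcu).symm
          (Cab_append_right hav hcv).symm⟩
      · have hau' : a ∈ u'.alph := (mem_alph_append.1 ha).resolve_left hau
        have hbu : b ∈ u.alph := (mem_alph_append.1 hb).resolve_right hbu'
        have hav : a ∉ v.alph := e ▸ hau
        have hav' : a ∈ v'.alph := e' ▸ hau'
        have hbv : b ∈ v.alph := e ▸ hbu
        have hbv' : b ∉ v'.alph := e' ▸ hbu'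
        refine ⟨iff_of_true (cDefined_append hu hu' hau hau' hbu' hbu)
          (cDefined_append hv hv' hav hav' hbv' hbv), fun _ _ => ?_⟩
        exact (ih (hu.YR b) (hv.YR b) (hu'.XL a) (hv'.XL a)
          ((eqvAux_WI.1 h).2.1 b hbu).2.2.2 ((eqvAux_WI.1 h').2.1 a hau').1).congr
          (Cab_append hu hu' hau hau' hbu' hbu).symm (Cab_append hv hv' hav hav' hbv' hbv).symm

/-- Any finite power with exponent larger than `n` of an accessible word is equivalent to the
`ω + ω*` power of an equivalent accessible word. -/
theorem eqvAux.gpow_fin_OO {n m j : ℕ} {k : ZK} {u v : GWord A} (hu : u.Accessible)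
    (hv : v.Accessible) (h : eqvAux n k m u v) (hj : n < j) :
    eqvAux n k m (u.gpow (Fin j)) (v.gpow OO) := by
  induction n generalizing m k j with
  | zero => exact eqvAux_zero_left ..
  | succ n ih =>
  cases m with
  | zero => exact eqvAux_zero_right ..
  | succ m =>
  obtain ⟨j, rfl⟩ : ∃ i, j = i + 2 := ⟨j - 2, by omega⟩
  have e : u.alph = v.alph := h.alph_eq
  have eu : (u.gpow (Fin (j + 2))).alph = u.alph := alph_gpow
  have eu' : (u.gpow (Fin (j + 1))).alph = u.alph := alph_gpow
  have ev : (v.gpow OO).alph = v.alph := alph_gpow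
  have halph : (u.gpow (Fin (j + 2))).alph = (v.gpow OO).alph := by rw [eu, ev, e]
  have hup := hu.gpow_fin j
  have hvp := hv.gpow_OO
  have hX : ∀ {a}, a ∈ u.alph → ∀ {m₁ m₂ k₁ k₂}, eqvAux n k₁ m₁ (u.XL a) (v.XL a) →
      eqvAux n k₂ m₂ (u.XR a) (v.XR a) → eqvAux n k₂ m₂ u v →
      eqvAux n k₁ m₁ ((u.gpow (Fin (j + 2))).XL a) ((v.gpow OO).XL a) ∧
      eqvAux n k₂ m₂ ((u.gpow (Fin (j + 2))).XR a) ((v.gpow OO).XR a) := by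
    intro a hau m₁ m₂ k₁ k₂ h₁ h₂ h₃
    have hav : a ∈ v.alph := e ▸ hau
    refine ⟨h₁.congr ?_ ?_, ((h₂.append (hu.XR a) (hv.XR a) hup hvp (ih h₃ (by omega)))).congr
      ?_ ?_⟩
    · exact (((gpow_fin_cons _).XL a).trans (append_XL_of_mem hu hau)).symm
    · exact ((gpow_OO_cons.XL a).trans (append_XL_of_mem hv hav)).symm
    · exact (((gpow_fin_cons _).XR a).trans (append_XR_of_mem hu hau)).symm
    · exact ((gpow_OO_cons.XR a).trans (append_XR_of_mem hv hav)).symm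
  have hY : ∀ {a}, a ∈ u.alph → ∀ {m₁ m₂ k₁ k₂}, eqvAux n k₁ m₁ (u.YL a) (v.YL a) →
      eqvAux n k₂ m₂ (u.YR a) (v.YR a) → eqvAux n k₁ m₁ u v →
      eqvAux n k₁ m₁ ((u.gpow (Fin (j + 2))).YL a) ((v.gpow OO).YL a) ∧
      eqvAux n k₂ m₂ ((u.gpow (Fin (j + 2))).YR a) ((v.gpow OO).YR a) := by
    intro a hau m₁ m₂ k₁ k₂ h₁ h₂ h₃
    have hav : a ∈ v.alph := e ▸ hau
    refine ⟨((ih h₃ (by omega)).append hup hvp (hu.YL a) (hv.YL a) h₁).congr ?_ ?_,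
      h₂.congr ?_ ?_⟩
    · exact (((gpow_fin_snoc _).YL a).trans (append_YL_of_mem hu hau)).symm
    · exact ((gpow_OO_snoc.YL a).trans (append_YL_of_mem hv hav)).symm
    · exact (((gpow_fin_snoc _).YR a).trans (append_YR_of_mem hu hau)).symm
    · exact ((gpow_OO_snoc.YR a).trans (append_YR_of_mem hv hav)).symm
  cases k with
  | X =>
    have h' := eqvAux_X.1 h
    rw [eqvAux_X, eu]
    exact ⟨e.trans ev.symm, ih h'.2.1 (by omega),
      fun a ha => hX ha (h'.2.2 a ha).1 (h'.2.2 a ha).2 h.of_succ_left⟩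
  | Y =>
    have h' := eqvAux_Y.1 h
    rw [eqvAux_Y, eu]
    exact ⟨e.trans ev.symm, ih h'.2.1 (by omega),
      fun a ha => hY ha (h'.2.2 a ha).1 (h'.2.2 a ha).2 h.of_succ_left⟩
  | WI =>
    have h' := eqvAux_WI.1 h
    rw [eqvAux_WI, eu]
    refine ⟨e.trans ev.symm, fun a ha => ?_, fun a ha b hb => ?_⟩
    · obtain ⟨h₁, h₂, h₃, h₄⟩ := h'.2.1 a ha
      exact and_assoc.1 ⟨hX ha h₁ h₂ h.of_succ_left, hY ha h₃ h₄ h.of_succ_left⟩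
    · have hnu : ¬ (u.gpow (Fin (j + 2))).CDefined a b := by
        rw [(gpow_fin_cons _).cDefined_iff]
        exact not_cDefined_append hu hup ha (eu'.symm ▸ hb)
      have hnv : ¬ (v.gpow OO).CDefined a b := by
        rw [gpow_OO_cons.cDefined_iff]
        exact not_cDefined_append hv hvp (e ▸ ha) (ev.symm ▸ e ▸ hb)
      exact ⟨iff_of_false hnu hnv, fun h => (hnu h).elim⟩

theorem eqvAux.mono_left {n n' m : ℕ} {k : ZK} {u v : GWord A} (h : eqvAux n k m u v)
    (hn : n' ≤ n) : eqvAux n' k m u v := by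
  induction hn with
  | refl => exact h
  | step _ ih => exact ih h.of_succ_left

end eqv

/-- Lemma: a sufficiently large finite power is as good as an `ω + ω*` power. -/
theorem finite_power_vs_omega_power (A : Type) [Fintype A] (m n : ℕ) (Z : ZKind)
    (u v : GWord A) (hu : u.Accessible) (hv : v.Accessible) (h : wEquiv Z m n u v) :
    ∀ k : ℕ, k ≤ n → wEquiv Z m k (u.gpow (Fin (k + 1))) (v.gpow OO) := by
  intro k hk
  have key : ∀ z : ZK, eqvAux n z m u v → eqvAux k z m (u.gpow (Fin (k + 1))) (v.gpow OO) :=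
    fun z hz => (hz.mono_left hk).gpow_fin_OO hu hv k.lt_succ_self
  cases Z
  exacts [key _ h, key _ h, ⟨key _ h.1, key _ h.2⟩, key _ h]
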